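/- Kullback–Leibler ordering of standard, general, and latent Vecchia (Proposition 4): In the latent-plus-noise Gaussian model, let q(i) ⊆ {1,…,i−1} for each i ∈ {1,…,ℓ}, and for each i let q(i) = q_y(i) ⊔ q_z(i) be an arbitrary partition. Define three probability densities on ℝ^{2ℓ} for the interleaved vector x: the latent Vecchia density f̂_l(x) = ∏_{i=1}^{ℓ} f(y_i | y_{q(i)}) · ∏_{i=1}^{ℓ} f(z_i | y_i); the general Vecchia density f̂_g(x) = ∏_{i=1}^{ℓ} f(y_i | y_{q_y(i)}, z_{q_z(i)}) · ∏_{i=1}^{ℓ} f(z_i | y_i); and the standard Vecchia density f̂_s(x) = ∏_{i=1}^{ℓ} f(y_i | z_{q(i)}) · ∏_{i=1}^{ℓ} f(z_i | y_i), where each factor is the exact conditional Gaussian density of the indicated scalar coordinate given the indicated coordinates under the joint Gaussian law f of x. Then KL(f ‖ f̂_l) ≤ KL(f ‖ f̂_g) ≤ KL(f ‖ f̂_s). -/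

import Mathlib

open Matrix Real MeasureTheory

/-- Conditional mean `C_{i,A} (C_{A,A})⁻¹ x_A` of coordinate `i` given the coordinates
in `A` under the centered Gaussian with covariance `C`. -/
noncomputable def cMean {ι : Type} [Fintype ι] [DecidableEq ι]
    (C : Matrix ι ι ℝ) (A : Finset ι) (i : ι) (x : ι → ℝ) : ℝ :=
  ∑ a ∈ A.attach, ∑ b ∈ A.attach,
    C i a.1 *
      ((C.submatrix (fun t : {u // u ∈ A} => t.1) (fun t : {u // u ∈ A} => t.1))⁻¹ a b) * x b.1

/-- Conditional variance `C_{i,i} − C_{i,A} (C_{A,A})⁻¹ C_{A,i}`. -/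
noncomputable def cVar {ι : Type} [Fintype ι] [DecidableEq ι]
    (C : Matrix ι ι ℝ) (A : Finset ι) (i : ι) : ℝ :=
  C i i - ∑ a ∈ A.attach, ∑ b ∈ A.attach,
    C i a.1 *
      ((C.submatrix (fun t : {u // u ∈ A} => t.1) (fun t : {u // u ∈ A} => t.1))⁻¹ a b) * C b.1 i

/-- The exact conditional Gaussian density of coordinate `i` given the coordinates
in `A`, evaluated at `x`. -/
noncomputable def cDens {ι : Type} [Fintype ι] [DecidableEq ι]
    (C : Matrix ι ι ℝ) (A : Finset ι) (i : ι) (x : ι → ℝ) : ℝ :=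
  (2 * π * cVar C A i) ^ (-(1/2) : ℝ) *
    Real.exp (-(x i - cMean C A i x) ^ 2 / (2 * cVar C A i))

open scoped MatrixOrder in
theorem Matrix.PosDef.exists_eq_transpose_mul_self {ι : Type*} [Fintype ι] [DecidableEq ι]
    {M : Matrix ι ι ℝ} (hM : M.PosDef) : ∃ B : Matrix ι ι ℝ, M = Bᵀ * B := by
  obtain ⟨B, hB⟩ := CStarAlgebra.nonneg_iff_eq_star_mul_self.mp hM.posSemidef.nonneg
  exact ⟨B, by simpa [star_eq_conjTranspose, conjTranspose_eq_transpose_of_trivial] using hB⟩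

theorem integrable_gaussianPDFReal_mul_pow (n : ℕ) :
    Integrable (fun t : ℝ => ProbabilityTheory.gaussianPDFReal 0 1 t * t ^ n) := by
  have h := (ProbabilityTheory.memLp_id_gaussianReal (μ := 0) (v := 1) n).integrable_norm_pow'
  rw [ProbabilityTheory.gaussianReal_of_var_ne_zero _ one_ne_zero,
    integrable_withDensity_iff (ProbabilityTheory.measurable_gaussianPDF _ _)
      (by simp [ProbabilityTheory.gaussianPDF])] at h
  refine h.mono' (by fun_prop) (ae_of_all _ fun t => ?_)
  simp [abs_of_nonneg (ProbabilityTheory.gaussianPDFReal_nonneg 0 1 t), mul_comm]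

theorem integral_gaussianPDFReal_mul_id :
    ∫ t : ℝ, ProbabilityTheory.gaussianPDFReal 0 1 t * t = 0 := by
  have h := ProbabilityTheory.integral_id_gaussianReal (μ := 0) (v := 1)
  rwa [ProbabilityTheory.integral_gaussianReal_eq_integral_smul one_ne_zero] at h

theorem integral_gaussianPDFReal_mul_sq :
    ∫ t : ℝ, ProbabilityTheory.gaussianPDFReal 0 1 t * t ^ 2 = 1 := by
  have h := ProbabilityTheory.variance_id_gaussianReal (μ := 0) (v := 1)
  rw [ProbabilityTheory.variance_eq_integral (by fun_prop)] at h
  simpa [ProbabilityTheory.integral_gaussianReal_eq_integral_smul one_ne_zero,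
    integral_gaussianPDFReal_mul_id] using h

/-- The standard Gaussian density on `ι → ℝ`. -/
noncomputable def stdGaussianDensity {ι : Type*} [Fintype ι] (u : ι → ℝ) : ℝ :=
  ∏ k, ProbabilityTheory.gaussianPDFReal 0 1 (u k)

theorem stdGaussianDensity_eq {ι : Type*} [Fintype ι] (u : ι → ℝ) :
    stdGaussianDensity u =
      (2 * π) ^ (-(Fintype.card ι : ℝ) / 2) * Real.exp (-(1/2) * (u ⬝ᵥ u)) := by
  simp only [stdGaussianDensity, ProbabilityTheory.gaussianPDFReal, Finset.prod_mul_distrib,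
    Finset.prod_const, Finset.card_univ, ← Real.exp_sum]
  congr 1
  · rw [NNReal.coe_one, mul_one, Real.sqrt_eq_rpow, ← Real.rpow_neg (by positivity),
      ← Real.rpow_natCast, ← Real.rpow_mul (by positivity)]
    congr 1; ring
  · simp only [dotProduct, Finset.mul_sum]
    congr 1
    exact Finset.sum_congr rfl fun k _ => by rw [NNReal.coe_one]; ring

theorem stdGaussianDensity_mul_sq_eq {ι : Type*} [Fintype ι] (v u : ι → ℝ) :
    stdGaussianDensity u * (v ⬝ᵥ u) ^ 2 =
      ∑ k, ∑ l, v k * v l * (stdGaussianDensity u * (u k * u l)) := by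
  rw [dotProduct, sq, Finset.sum_mul_sum, Finset.mul_sum]
  simp only [Finset.mul_sum]
  exact Finset.sum_congr rfl fun k _ => Finset.sum_congr rfl fun l _ => by ring

theorem integrable_stdGaussianDensity {ι : Type*} [Fintype ι] :
    Integrable (stdGaussianDensity (ι := ι)) :=
  Integrable.fintype_prod fun _ => ProbabilityTheory.integrable_gaussianPDFReal 0 1

theorem integral_stdGaussianDensity {ι : Type*} [Fintype ι] :
    ∫ u : ι → ℝ, stdGaussianDensity u = 1 := by
  simp only [stdGaussianDensity]
  rw [integral_fintype_prod_volume_eq_prod fun _ => ProbabilityTheory.gaussianPDFReal 0 1]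
  simp [ProbabilityTheory.integral_gaussianPDFReal_eq_one]

section
variable {ι : Type*} [Fintype ι] [DecidableEq ι]

theorem stdGaussianDensity_mul_mul_eq (k l : ι) (u : ι → ℝ) :
    stdGaussianDensity u * (u k * u l) =
      ∏ m, ProbabilityTheory.gaussianPDFReal 0 1 (u m) *
        u m ^ ((if m = k then 1 else 0) + if m = l then 1 else 0) := by
  simp only [stdGaussianDensity, Finset.prod_mul_distrib, pow_add, pow_ite, pow_one, pow_zero,
    Finset.prod_ite_eq', Finset.mem_univ, if_true]

theorem integrable_stdGaussianDensity_mul_mul (k l : ι) :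
    Integrable (fun u : ι → ℝ => stdGaussianDensity u * (u k * u l)) := by
  simp only [stdGaussianDensity_mul_mul_eq]
  exact Integrable.fintype_prod (f := fun m t => ProbabilityTheory.gaussianPDFReal 0 1 t *
        t ^ ((if m = k then 1 else 0) + if m = l then 1 else 0))
    fun _ => integrable_gaussianPDFReal_mul_pow _

theorem integral_stdGaussianDensity_mul_mul (k l : ι) :
    ∫ u : ι → ℝ, stdGaussianDensity u * (u k * u l) = if k = l then 1 else 0 := by
  simp only [stdGaussianDensity_mul_mul_eq]
  rw [integral_fintype_prod_volume_eq_prod (fun m t => ProbabilityTheory.gaussianPDFReal 0 1 t *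
        t ^ ((if m = k then 1 else 0) + if m = l then 1 else 0))]
  split_ifs with h
  · subst h
    refine Finset.prod_eq_one fun m _ => ?_
    split_ifs
    · exact integral_gaussianPDFReal_mul_sq
    · simpa using ProbabilityTheory.integral_gaussianPDFReal_eq_one 0 one_ne_zero
  · refine Finset.prod_eq_zero (Finset.mem_univ k) ?_
    simpa [h] using integral_gaussianPDFReal_mul_id

theorem integrable_stdGaussianDensity_mul_sq (v : ι → ℝ) :
    Integrable (fun u : ι → ℝ => stdGaussianDensity u * (v ⬝ᵥ u) ^ 2) := by
  simp only [stdGaussianDensity_mul_sq_eq]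
  exact integrable_finsetSum _ fun k _ => integrable_finsetSum _ fun l _ =>
    (integrable_stdGaussianDensity_mul_mul k l).const_mul _

theorem integral_stdGaussianDensity_mul_sq (v : ι → ℝ) :
    ∫ u : ι → ℝ, stdGaussianDensity u * (v ⬝ᵥ u) ^ 2 = v ⬝ᵥ v := by
  simp only [stdGaussianDensity_mul_sq_eq]
  have h_integrable (k l : ι) := (integrable_stdGaussianDensity_mul_mul k l).const_mul (v k * v l)
  rw [integral_finsetSum _ fun k _ => integrable_finsetSum _ fun l _ => h_integrable k l]
  refine Finset.sum_congr rfl fun k _ => ?_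
  rw [integral_finsetSum _ fun l _ => h_integrable k l]
  simp [integral_const_mul, integral_stdGaussianDensity_mul_mul]

theorem measurableEmbedding_mulVec {B : Matrix ι ι ℝ} (hB : B.det ≠ 0) :
    MeasurableEmbedding (fun x : ι → ℝ => B *ᵥ x) := by
  refine Topology.IsClosedEmbedding.measurableEmbedding ?_
  exact LinearMap.isClosedEmbedding_of_injective (f := toLin' B)
    (LinearMap.ker_eq_bot.mpr (mulVec_injective_of_isUnit
      ((isUnit_iff_isUnit_det B).mpr hB.isUnit)))

theorem map_mulVec_volume {B : Matrix ι ι ℝ} (hB : B.det ≠ 0) :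
    Measure.map (fun x : ι → ℝ => B *ᵥ x) volume = ENNReal.ofReal |(B.det)⁻¹| • volume :=
  Real.map_matrix_volume_pi_eq_smul_volume_pi hB

theorem integrable_comp_mulVec {B : Matrix ι ι ℝ} (hB : B.det ≠ 0) {g : (ι → ℝ) → ℝ}
    (hg : Integrable g) : Integrable (fun x => g (B *ᵥ x)) := by
  refine (measurableEmbedding_mulVec hB).integrable_map_iff.mp ?_
  rw [map_mulVec_volume hB]
  exact hg.smul_measure ENNReal.ofReal_ne_top

theorem integral_comp_mulVec {B : Matrix ι ι ℝ} (hB : B.det ≠ 0) (g : (ι → ℝ) → ℝ) :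
    |B.det| * ∫ x, g (B *ᵥ x) = ∫ x, g x := by
  rw [← (measurableEmbedding_mulVec hB).integral_map, map_mulVec_volume hB, integral_smul_measure,
    ENNReal.toReal_ofReal (abs_nonneg _), abs_inv, smul_eq_mul,
    mul_inv_cancel_left₀ (abs_ne_zero.mpr hB)]

/-- The centered Gaussian density with covariance matrix `C`. -/
noncomputable def gaussianDensity (C : Matrix ι ι ℝ) (x : ι → ℝ) : ℝ :=
  (2 * π) ^ (-(Fintype.card ι : ℝ) / 2) * C.det ^ (-(1/2) : ℝ) *
    Real.exp (-(1/2) * (x ⬝ᵥ (C⁻¹ *ᵥ x)))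

theorem gaussianDensity_pos {C : Matrix ι ι ℝ} (hC : C.PosDef) (x : ι → ℝ) :
    0 < gaussianDensity C x := by
  have := hC.det_pos
  unfold gaussianDensity
  positivity

theorem Matrix.PosDef.exists_whitening {C : Matrix ι ι ℝ} (hC : C.PosDef) :
    ∃ B : Matrix ι ι ℝ, C⁻¹ = Bᵀ * B ∧ B.det ≠ 0 ∧
      (∀ x, gaussianDensity C x = |B.det| * stdGaussianDensity (B *ᵥ x)) ∧
      ∀ w : ι → ℝ, ∃ v : ι → ℝ, (∀ x, w ⬝ᵥ x = v ⬝ᵥ (B *ᵥ x)) ∧ v ⬝ᵥ v = w ⬝ᵥ (C *ᵥ w) := by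
  obtain ⟨B, hB⟩ := hC.inv.exists_eq_transpose_mul_self
  have hCdet : IsUnit C.det := hC.det_pos.ne'.isUnit
  have hdet : C.det = (|B.det| ^ 2)⁻¹ := by
    have h := congrArg det hB
    rw [det_nonsing_inv, Ring.inverse_eq_inv', det_mul, det_transpose] at h
    rw [sq_abs, sq, ← h, inv_inv]
  have hB0 : B.det ≠ 0 := by
    intro h
    apply hCdet.ne_zero
    simp [hdet, h]
  refine ⟨B, hB, hB0, fun x => ?_, fun w => ⟨w ᵥ* B⁻¹, fun x => ?_, ?_⟩⟩
  · have h1 : C.det ^ (-(1/2) : ℝ) = |B.det| := by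
      rw [hdet, Real.rpow_neg (by positivity), Real.inv_rpow (by positivity), inv_inv,
        ← Real.sqrt_eq_rpow, Real.sqrt_sq (abs_nonneg _)]
    rw [gaussianDensity, stdGaussianDensity_eq, h1, hB, ← mulVec_mulVec, dotProduct_mulVec,
      vecMul_transpose]
    ring
  · rw [dotProduct_mulVec, vecMul_vecMul, nonsing_inv_mul _ hB0.isUnit, vecMul_one]
  · have h2 : C = B⁻¹ * (B⁻¹)ᵀ := by
      rw [← nonsing_inv_nonsing_inv C hCdet, hB, Matrix.mul_inv_rev, transpose_nonsing_inv]
    conv_rhs => rw [h2, ← mulVec_mulVec, mulVec_transpose, dotProduct_mulVec]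

section
variable {C : Matrix ι ι ℝ}

theorem integrable_gaussianDensity (hC : C.PosDef) : Integrable (gaussianDensity C) := by
  obtain ⟨B, -, hB0, hf, -⟩ := hC.exists_whitening
  rw [funext hf]
  exact (integrable_comp_mulVec hB0 integrable_stdGaussianDensity).const_mul _

theorem integral_gaussianDensity (hC : C.PosDef) : ∫ x, gaussianDensity C x = 1 := by
  obtain ⟨B, -, hB0, hf, -⟩ := hC.exists_whitening
  simp only [hf]
  rw [integral_const_mul, integral_comp_mulVec hB0, integral_stdGaussianDensity]

theorem integrable_gaussianDensity_mul_sq (hC : C.PosDef) (w : ι → ℝ) :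
    Integrable (fun x => gaussianDensity C x * (w ⬝ᵥ x) ^ 2) := by
  obtain ⟨B, -, hB0, hf, hv⟩ := hC.exists_whitening
  obtain ⟨v, hvx, -⟩ := hv w
  simp only [hf, hvx, mul_assoc]
  exact (integrable_comp_mulVec hB0 (integrable_stdGaussianDensity_mul_sq v)).const_mul _

theorem integral_gaussianDensity_mul_sq (hC : C.PosDef) (w : ι → ℝ) :
    ∫ x, gaussianDensity C x * (w ⬝ᵥ x) ^ 2 = w ⬝ᵥ (C *ᵥ w) := by
  obtain ⟨B, -, hB0, hf, hv⟩ := hC.exists_whitening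
  obtain ⟨v, hvx, hvv⟩ := hv w
  rw [← hvv]
  simp only [hf, hvx, mul_assoc]
  rw [integral_const_mul, integral_comp_mulVec hB0 fun u => stdGaussianDensity u * (v ⬝ᵥ u) ^ 2,
    integral_stdGaussianDensity_mul_sq]

theorem integrable_gaussianDensity_mul_log (hC : C.PosDef) :
    Integrable (fun x => gaussianDensity C x * Real.log (gaussianDensity C x)) := by
  obtain ⟨B, hB, -, -⟩ := hC.exists_whitening
  have hdet := hC.det_pos
  have h (x : ι → ℝ) : gaussianDensity C x * Real.log (gaussianDensity C x) =
      gaussianDensity C x *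
        Real.log ((2 * π) ^ (-(Fintype.card ι : ℝ) / 2) * C.det ^ (-(1/2) : ℝ)) -
      1 / 2 * ∑ k, gaussianDensity C x * (B k ⬝ᵥ x) ^ 2 := by
    have hq : x ⬝ᵥ (C⁻¹ *ᵥ x) = ∑ k, (B k ⬝ᵥ x) ^ 2 := by
      rw [hB, ← mulVec_mulVec, dotProduct_mulVec, vecMul_transpose]
      exact Finset.sum_congr rfl fun k _ => (sq _).symm
    conv_lhs => rw [gaussianDensity, Real.log_mul (by positivity) (Real.exp_ne_zero _),
      Real.log_exp, ← gaussianDensity, hq]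
    rw [← Finset.mul_sum]
    ring
  simp only [h]
  exact ((integrable_gaussianDensity hC).mul_const _).sub
    ((integrable_finsetSum _ fun k _ => integrable_gaussianDensity_mul_sq hC (B k)).const_mul _)

end

end

section
variable {ι : Type} [Fintype ι] [DecidableEq ι] {C : Matrix ι ι ℝ}

theorem cVar_eq_sub_cMean (hC : C.IsHermitian) (A : Finset ι) (i : ι) :
    cVar C A i = C i i - cMean C A i (C i) := by
  simp only [cVar, cMean]
  congr 1
  exact Finset.sum_congr rfl fun a _ => Finset.sum_congr rfl fun b _ => by
    rw [← hC.apply i b.1, star_trivial]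

theorem cMean_row_of_mem (hC : C.PosDef) {A : Finset ι} {k : ι} (hk : k ∈ A) (i : ι) :
    cMean C A i (C k) = C k i := by
  set M := C.submatrix (fun t : {u // u ∈ A} => t.1) (fun t : {u // u ∈ A} => t.1) with hM
  have hMpos : M.PosDef := hC.submatrix Subtype.val_injective
  have hMM : M⁻¹ * M = 1 := nonsing_inv_mul _ hMpos.det_pos.ne'.isUnit
  have hb (a : {u // u ∈ A}) :
      ∑ b ∈ A.attach, M⁻¹ a b * C k b.1 = if a = ⟨k, hk⟩ then 1 else 0 := by
    have := congrFun (congrFun hMM a) ⟨k, hk⟩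
    rw [one_apply, mul_apply, Finset.univ_eq_attach] at this
    rw [← this]
    refine Finset.sum_congr rfl fun b _ => ?_
    rw [← hC.1.apply k b.1, star_trivial, hM, submatrix_apply]
  simp only [cMean, mul_assoc, ← Finset.mul_sum]
  rw [← hM]
  simp only [hb]
  simp [← hC.1.apply k i]

theorem exists_residual (hC : C.PosDef) {A : Finset ι} {i : ι} (hi : i ∉ A) :
    ∃ w : ι → ℝ, w i = 1 ∧ (∀ k ∉ insert i A, w k = 0) ∧
      (∀ x, w ⬝ᵥ x = x i - cMean C A i x) ∧ (∀ a ∈ A, (C *ᵥ w) a = 0) ∧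
      (C *ᵥ w) i = cVar C A i := by
  set M := C.submatrix (fun t : {u // u ∈ A} => t.1) (fun t : {u // u ∈ A} => t.1) with hM
  let c : ι → ℝ := fun k => if hk : k ∈ A then ∑ a ∈ A.attach, C i a.1 * M⁻¹ a ⟨k, hk⟩ else 0
  have hx (x : ι → ℝ) : (Pi.single i 1 - c) ⬝ᵥ x = x i - cMean C A i x := by
    rw [sub_dotProduct, single_dotProduct, one_mul, cMean, Finset.sum_comm, dotProduct,
      ← Finset.sum_subset (Finset.subset_univ A) (fun k _ hk => by simp [c, hk]),
      ← Finset.sum_attach A]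
    congr 1
    refine Finset.sum_congr rfl fun b _ => ?_
    simp [c, Finset.sum_mul, hM]
  refine ⟨Pi.single i 1 - c, by simp [c, hi], fun k hk => ?_, hx, fun a ha => ?_, ?_⟩
  · rw [Finset.mem_insert, not_or] at hk
    simp [c, hk.1, hk.2]
  · rw [mulVec, dotProduct_comm, hx, cMean_row_of_mem hC ha, sub_self]
  · rw [mulVec, dotProduct_comm, hx, cVar_eq_sub_cMean hC.1]

theorem exists_residual_variance (hC : C.PosDef) {A : Finset ι} {i : ι} (hi : i ∉ A) :
    ∃ w : ι → ℝ, w i = 1 ∧ (∀ k ∉ insert i A, w k = 0) ∧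
      (∀ x, w ⬝ᵥ x = x i - cMean C A i x) ∧ w ⬝ᵥ (C *ᵥ w) = cVar C A i := by
  obtain ⟨w, hwi, hw0, hwx, hCA, hCi⟩ := exists_residual hC hi
  refine ⟨w, hwi, hw0, hwx, ?_⟩
  rw [dotProduct, Finset.sum_eq_single i, hwi, one_mul, hCi]
  · intro k _ hki
    by_cases hk : k ∈ A
    · rw [hCA k hk, mul_zero]
    · rw [hw0 k (by simp [hki, hk]), zero_mul]
  · simp

theorem cVar_pos (hC : C.PosDef) {A : Finset ι} {i : ι} (hi : i ∉ A) : 0 < cVar C A i := by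
  obtain ⟨w, hwi, -, -, hw⟩ := exists_residual_variance hC hi
  rw [← hw]
  refine hC.dotProduct_mulVec_pos fun h => ?_
  simp [h] at hwi

/-- The conditional variance is the least variance of a residual `x i - ∑ a ∈ A, b a * x a`. -/
theorem cVar_le (hC : C.PosDef) {A : Finset ι} {i : ι} (hi : i ∉ A) {v : ι → ℝ}
    (hvi : v i = 1) (hv : ∀ k ∉ insert i A, v k = 0) : cVar C A i ≤ v ⬝ᵥ (C *ᵥ v) := by
  obtain ⟨w, hwi, hw0, hwx, hCA, hCi⟩ := exists_residual hC hi
  obtain ⟨d, rfl⟩ : ∃ d, v = w + d := ⟨v - w, by simp⟩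
  have horth (u : ι → ℝ) (hu : ∀ k ∉ insert i A, u k = 0) :
      u ⬝ᵥ (C *ᵥ w) = u i * cVar C A i := by
    rw [dotProduct, Finset.sum_eq_single i, hCi]
    · intro k _ hki
      by_cases hk : k ∈ A
      · rw [hCA k hk, mul_zero]
      · rw [hu k (by simp [hki, hk]), zero_mul]
    · simp
  have hd0 : d i = 0 := by simpa [hwi] using hvi
  have hd : d ⬝ᵥ (C *ᵥ w) = 0 := by
    rw [horth d fun k hk => by simpa [hw0 k hk] using hv k hk, hd0, zero_mul]
  have hd' : w ⬝ᵥ (C *ᵥ d) = 0 := by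
    have hCT : Cᵀ = C := by simpa [conjTranspose_eq_transpose_of_trivial] using hC.1.eq
    rw [dotProduct_mulVec, ← mulVec_transpose, hCT, dotProduct_comm, hd]
  have hdd := hC.posSemidef.dotProduct_mulVec_nonneg d
  rw [star_trivial] at hdd
  rw [mulVec_add, add_dotProduct, dotProduct_add, dotProduct_add, hd, hd', horth w hw0, hwi]
  linarith

theorem cDens_pos (hC : C.PosDef) {A : Finset ι} {i : ι} (hi : i ∉ A) (x : ι → ℝ) :
    0 < cDens C A i x := by
  have := cVar_pos hC hi
  unfold cDens
  positivity

theorem gaussianDensity_mul_log_cDens (hC : C.PosDef) {A : Finset ι} {i : ι} (hi : i ∉ A) :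
    ∃ w : ι → ℝ, w ⬝ᵥ (C *ᵥ w) = cVar C A i ∧
      ∀ x, gaussianDensity C x * Real.log (cDens C A i x) =
        gaussianDensity C x * (-(1/2) * Real.log (2 * π * cVar C A i)) -
          (2 * cVar C A i)⁻¹ * (gaussianDensity C x * (w ⬝ᵥ x) ^ 2) := by
  obtain ⟨w, -, -, hwx, hw⟩ := exists_residual_variance hC hi
  refine ⟨w, hw, fun x => ?_⟩
  have := cVar_pos hC hi
  rw [cDens, Real.log_mul (by positivity) (Real.exp_ne_zero _), Real.log_exp,
    Real.log_rpow (by positivity), hwx]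
  ring

theorem integrable_gaussianDensity_mul_log_cDens (hC : C.PosDef) {A : Finset ι} {i : ι}
    (hi : i ∉ A) : Integrable (fun x => gaussianDensity C x * Real.log (cDens C A i x)) := by
  obtain ⟨w, -, h⟩ := gaussianDensity_mul_log_cDens hC hi
  simp only [h]
  exact ((integrable_gaussianDensity hC).mul_const _).sub
    ((integrable_gaussianDensity_mul_sq hC w).const_mul _)

theorem integral_gaussianDensity_mul_log_cDens (hC : C.PosDef) {A : Finset ι} {i : ι}
    (hi : i ∉ A) : ∫ x, gaussianDensity C x * Real.log (cDens C A i x) =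
      -(1/2) * Real.log (2 * π * cVar C A i) - 1/2 := by
  obtain ⟨w, hw, h⟩ := gaussianDensity_mul_log_cDens hC hi
  have := cVar_pos hC hi
  simp only [h]
  rw [integral_sub ((integrable_gaussianDensity hC).mul_const _)
    ((integrable_gaussianDensity_mul_sq hC w).const_mul _), integral_mul_const, integral_const_mul,
    integral_gaussianDensity hC, integral_gaussianDensity_mul_sq hC, hw]
  field_simp

theorem integral_gaussianDensity_mul_log_div_prod_cDens (hC : C.PosDef) {κ : Type*} [Fintype κ]
    {A : κ → Finset ι} {p : κ → ι} (hp : ∀ k, p k ∉ A k) :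
    ∫ x, gaussianDensity C x * Real.log (gaussianDensity C x / ∏ k, cDens C (A k) (p k) x) =
      (∫ x, gaussianDensity C x * Real.log (gaussianDensity C x)) +
        ∑ k, (1/2 * Real.log (2 * π * cVar C (A k) (p k)) + 1/2) := by
  have h (x : ι → ℝ) :
      gaussianDensity C x * Real.log (gaussianDensity C x / ∏ k, cDens C (A k) (p k) x) =
        gaussianDensity C x * Real.log (gaussianDensity C x) -
          ∑ k, gaussianDensity C x * Real.log (cDens C (A k) (p k) x) := by
    rw [Real.log_div (gaussianDensity_pos hC x).ne'
      (Finset.prod_pos fun k _ => cDens_pos hC (hp k) x).ne',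
      Real.log_prod fun k _ => (cDens_pos hC (hp k) x).ne', ← Finset.mul_sum, mul_sub]
  have h_integrable (k : κ) := integrable_gaussianDensity_mul_log_cDens hC (hp k)
  simp only [h]
  rw [integral_sub (integrable_gaussianDensity_mul_log hC)
      (integrable_finsetSum _ fun k _ => h_integrable k),
    integral_finsetSum _ fun k _ => h_integrable k, sub_eq_add_neg, ← Finset.sum_neg_distrib]
  congr 1
  refine Finset.sum_congr rfl fun k _ => ?_
  rw [integral_gaussianDensity_mul_log_cDens hC (hp k)]
  ring

/-- For products of conditional densities with the same targets, smaller conditional variances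
give a smaller Kullback–Leibler divergence. -/
theorem integral_log_div_prod_cDens_mono (hC : C.PosDef) {κ : Type*} [Fintype κ]
    {A A' : κ → Finset ι} {p : κ → ι} (hp : ∀ k, p k ∉ A k) (hp' : ∀ k, p k ∉ A' k)
    (hle : ∀ k, cVar C (A k) (p k) ≤ cVar C (A' k) (p k)) :
    ∫ x, gaussianDensity C x * Real.log (gaussianDensity C x / ∏ k, cDens C (A k) (p k) x) ≤
      ∫ x, gaussianDensity C x *
        Real.log (gaussianDensity C x / ∏ k, cDens C (A' k) (p k) x) := by
  rw [integral_gaussianDensity_mul_log_div_prod_cDens hC hp,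
    integral_gaussianDensity_mul_log_div_prod_cDens hC hp']
  have hpos (k : κ) := cVar_pos hC (hp k)
  gcongr with k
  · have := hpos k; positivity
  · exact hle k

end

section
variable {ℓ : ℕ} {K : Matrix (Fin ℓ) (Fin ℓ) ℝ} {τ : ℝ}
  {C : Matrix (Fin ℓ × Bool) (Fin ℓ × Bool) ℝ}

theorem latent_dotProduct_mulVec
    (hC : ∀ p r : Fin ℓ × Bool, C p r =
      K p.1 r.1 + if p.2 = true ∧ r.2 = true ∧ p.1 = r.1 then τ ^ 2 else 0)
    (v : Fin ℓ × Bool → ℝ) :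
    v ⬝ᵥ (C *ᵥ v) =
      (fun j => v (j, false) + v (j, true)) ⬝ᵥ (K *ᵥ fun j => v (j, false) + v (j, true)) +
        τ ^ 2 * ∑ j, v (j, true) ^ 2 := by
  simp only [dotProduct, mulVec, Fintype.sum_prod_type, Fintype.sum_bool, hC, Finset.mul_sum,
    ← Finset.sum_add_distrib]
  refine Finset.sum_congr rfl fun j _ => ?_
  have h : τ ^ 2 * v (j, true) ^ 2 =
      ∑ k, if j = k then v (j, true) * (τ ^ 2 * v (k, true)) else 0 := by
    simp; ring
  rw [h, ← Finset.sum_add_distrib]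
  refine Finset.sum_congr rfl fun k _ => ?_
  by_cases hjk : j = k <;> simp [hjk] <;> ring

theorem latent_posDef (hK : K.PosDef) (hτ : 0 < τ)
    (hC : ∀ p r : Fin ℓ × Bool, C p r =
      K p.1 r.1 + if p.2 = true ∧ r.2 = true ∧ p.1 = r.1 then τ ^ 2 else 0) : C.PosDef := by
  refine .of_dotProduct_mulVec_pos ?_ fun v hv => ?_
  · ext p r
    rw [conjTranspose_apply, star_trivial, hC, hC, ← hK.1.apply p.1 r.1, star_trivial]
    congr 1
    exact if_congr (by tauto) rfl rfl
  · rw [star_trivial, latent_dotProduct_mulVec hC]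
    have hKn := hK.posSemidef.dotProduct_mulVec_nonneg fun j => v (j, false) + v (j, true)
    rw [star_trivial] at hKn
    by_cases hz : ∃ j, v (j, true) ≠ 0
    · obtain ⟨j, hj⟩ := hz
      have : 0 < ∑ j, v (j, true) ^ 2 :=
        Finset.sum_pos' (fun _ _ => sq_nonneg _) ⟨j, Finset.mem_univ j, by positivity⟩
      positivity
    · push Not at hz
      simp only [hz, add_zero]
      have hy : (fun j => v (j, false)) ≠ 0 := by
        refine fun h => hv ?_
        ext ⟨j, b⟩
        cases b
        · exact congrFun h j
        · exact hz j
      have := hK.dotProduct_mulVec_pos hy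
      rw [star_trivial] at this
      simpa using this

/-- Replacing conditioning on latent values by conditioning on their noisy observations
increases the conditional variance. Here `s j` tells whether `j` is observed with noise. -/
theorem latent_cVar_mono (hK : K.PosDef) (hτ : 0 < τ)
    (hC : ∀ p r : Fin ℓ × Bool, C p r =
      K p.1 r.1 + if p.2 = true ∧ r.2 = true ∧ p.1 = r.1 then τ ^ 2 else 0)
    {q : Finset (Fin ℓ)} {i : Fin ℓ} (hi : i ∉ q) {s s' : Fin ℓ → Bool}
    (hs : ∀ j ∈ q, s j = true → s' j = true) :
    cVar C (q.image fun j => (j, s j)) (i, false) ≤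
      cVar C (q.image fun j => (j, s' j)) (i, false) := by
  have hCpos := latent_posDef hK hτ hC
  have hmem (t : Fin ℓ → Bool) (k : Fin ℓ) (b : Bool) :
      (k, b) ∈ insert (i, false) (q.image fun j => (j, t j)) ↔
        (k = i ∧ b = false) ∨ (k ∈ q ∧ t k = b) := by
    simp
  have hnot (t : Fin ℓ → Bool) : (i, false) ∉ q.image fun j => (j, t j) := by simp [hi]
  obtain ⟨w, hwi, hw0, -, hw⟩ := exists_residual_variance hCpos (hnot s')
  let v : Fin ℓ × Bool → ℝ := fun p =>
    if s p.1 then w p else if p.2 then 0 else w (p.1, false) + w (p.1, true)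
  have hsum (j : Fin ℓ) : v (j, false) + v (j, true) = w (j, false) + w (j, true) := by
    cases h : s j <;> simp [v, h]
  have hwit : w (i, true) = 0 := hw0 _ (by simp [hi])
  refine (cVar_le hCpos (hnot s) (v := v) ?_ ?_).trans ?_
  · simp [v, hwi, hwit]
  · rintro ⟨k, b⟩ hk
    rw [hmem] at hk
    have hw0' (b : Bool) (h : ¬ ((k = i ∧ b = false) ∨ (k ∈ q ∧ s' k = b))) : w (k, b) = 0 :=
      hw0 _ (by rwa [hmem])
    have hsk := hs k
    cases hsk' : s k <;> cases b <;> simp_all [v]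
  · rw [← hw, latent_dotProduct_mulVec hC, latent_dotProduct_mulVec hC]
    simp only [hsum]
    gcongr _ + _ * ?_
    refine Finset.sum_le_sum fun j _ => ?_
    cases h : s j <;> simp [v, h, sq_nonneg]

end


/-- Kullback–Leibler ordering of standard, general, and latent Vecchia (Proposition 4).
The interleaved vector `x = (y₁, z₁, …, y_ℓ, z_ℓ)` is indexed by `Fin ℓ × Bool`, where
`(i, false)` is the latent coordinate `y_i` and `(i, true)` the observed `z_i`; its
covariance matrix is `C`, built from `K` and `τ`. The KL divergence from the exact joint
Gaussian density `f` to a Vecchia density `h` is `∫ f(x) log (f(x) / h(x)) dx`. -/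
theorem stmt_10 (ℓ : ℕ) (hℓ : 0 < ℓ) (K : Matrix (Fin ℓ) (Fin ℓ) ℝ) (hK : K.PosDef)
    (τ : ℝ) (hτ : 0 < τ)
    (C : Matrix (Fin ℓ × Bool) (Fin ℓ × Bool) ℝ)
    (hC : ∀ p r : Fin ℓ × Bool, C p r =
      K p.1 r.1 + if p.2 = true ∧ r.2 = true ∧ p.1 = r.1 then τ ^ 2 else 0)
    (q qy qz : Fin ℓ → Finset (Fin ℓ))
    (hq : ∀ i : Fin ℓ, ∀ j ∈ q i, j < i)
    (hunion : ∀ i : Fin ℓ, qy i ∪ qz i = q i)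
    (hdisj : ∀ i : Fin ℓ, Disjoint (qy i) (qz i)) :
    let f : ((Fin ℓ × Bool) → ℝ) → ℝ := fun x =>
      (2 * π) ^ (-((2 * ℓ : ℕ) : ℝ) / 2) * C.det ^ (-(1/2) : ℝ) *
        Real.exp (-(1/2) * (x ⬝ᵥ (C⁻¹ *ᵥ x)))
    let fl : ((Fin ℓ × Bool) → ℝ) → ℝ := fun x =>
      (∏ i : Fin ℓ, cDens C ((q i).image (fun j => (j, false))) (i, false) x) *
        ∏ i : Fin ℓ, cDens C {((i, false) : Fin ℓ × Bool)} (i, true) x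
    let fg : ((Fin ℓ × Bool) → ℝ) → ℝ := fun x =>
      (∏ i : Fin ℓ, cDens C
          ((qy i).image (fun j => (j, false)) ∪ (qz i).image (fun j => (j, true)))
          (i, false) x) *
        ∏ i : Fin ℓ, cDens C {((i, false) : Fin ℓ × Bool)} (i, true) x
    let fs : ((Fin ℓ × Bool) → ℝ) → ℝ := fun x =>
      (∏ i : Fin ℓ, cDens C ((q i).image (fun j => (j, true))) (i, false) x) *
        ∏ i : Fin ℓ, cDens C {((i, false) : Fin ℓ × Bool)} (i, true) x
    let KL : (((Fin ℓ × Bool) → ℝ) → ℝ) → ℝ := fun h =>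
      ∫ x : (Fin ℓ × Bool) → ℝ, f x * Real.log (f x / h x)
    KL fl ≤ KL fg ∧ KL fg ≤ KL fs := by
  intro f fl fg fs KL
  have hCpos := latent_posDef hK hτ hC
  have hf : f = gaussianDensity C := by
    funext x
    simp [f, gaussianDensity, mul_comm]
  have hi (i : Fin ℓ) : i ∉ q i := fun h => lt_irrefl i (hq i i h)
  let A (s : Fin ℓ → Fin ℓ → Bool) : Fin ℓ ⊕ Fin ℓ → Finset (Fin ℓ × Bool) :=
    Sum.elim (fun i => (q i).image fun j => (j, s i j)) fun i => {(i, false)}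
  let p : Fin ℓ ⊕ Fin ℓ → Fin ℓ × Bool := Sum.elim (fun i => (i, false)) fun i => (i, true)
  have hp (s : Fin ℓ → Fin ℓ → Bool) (k : Fin ℓ ⊕ Fin ℓ) : p k ∉ A s k := by
    rcases k with i | i <;> simp [p, A, hi]
  let h (s : Fin ℓ → Fin ℓ → Bool) : (Fin ℓ × Bool → ℝ) → ℝ :=
    fun x => ∏ k, cDens C (A s k) (p k) x
  have hmono (s s' : Fin ℓ → Fin ℓ → Bool) (hs : ∀ i, ∀ j ∈ q i, s i j = true → s' i j = true) :
      KL (h s) ≤ KL (h s') := by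
    simp only [KL, hf]
    refine integral_log_div_prod_cDens_mono hCpos (hp s) (hp s') fun k => ?_
    rcases k with i | i
    · exact latent_cVar_mono hK hτ hC (hi i) (hs i)
    · exact le_rfl
  have hl : fl = h fun _ _ => false := by
    funext x
    simp [fl, h, A, p, Fintype.prod_sum_type]
  have hs : fs = h fun _ _ => true := by
    funext x
    simp [fs, h, A, p, Fintype.prod_sum_type]
  have hg : fg = h fun i j => decide (j ∈ qz i) := by
    have hA (i : Fin ℓ) : (qy i).image (fun j => (j, false)) ∪ (qz i).image (fun j => (j, true)) =
        (q i).image fun j => (j, decide (j ∈ qz i)) := by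
      rw [← hunion, Finset.image_union]
      congr 1
      · exact Finset.image_congr fun j hj => by
          simp [Finset.disjoint_left.mp (hdisj i) (Finset.mem_coe.mp hj)]
      · exact Finset.image_congr fun j hj => by simp [Finset.mem_coe.mp hj]
    funext x
    simp [fg, h, A, p, Fintype.prod_sum_type, hA]
  rw [hl, hg, hs]
  exact ⟨hmono _ _ (by simp), hmono _ _ (by simp)⟩
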